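/- arXiv:1609.06999 — 2 statements merged into one kernel-verified Lean document; each statement's English description precedes it below -/
import Mathlib

section
/- Let k ∈ ℤ with k < 1 and let f : ℍ → ℂ be smooth with Δ_k f = 0. Then L_{2−k}(R_k^{1−k} f) = 0, i.e. the (1−k)-fold raised function R_k^{1−k} f is holomorphic on ℍ. -/
open Complex

noncomputable section

/-- The upper half-plane, as a subset of `ℂ`. -/
def UH : Set ℂ := {z : ℂ | 0 < z.im}

/-- Partial derivative in the direction of the real axis, `∂f/∂u`. -/
noncomputable def du (f : ℂ → ℂ) (z : ℂ) : ℂ := fderiv ℝ f z 1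

/-- Partial derivative in the direction of the imaginary axis, `∂f/∂v`. -/
noncomputable def dv (f : ℂ → ℂ) (z : ℂ) : ℂ := fderiv ℝ f z Complex.I

/-- The Wirtinger derivative `∂_τ f = (1/2)(∂f/∂u − i ∂f/∂v)`. -/
noncomputable def dtau (f : ℂ → ℂ) (z : ℂ) : ℂ :=
  (1 / 2) * (du f z - Complex.I * dv f z)

/-- The Wirtinger derivative `∂_τ̄ f = (1/2)(∂f/∂u + i ∂f/∂v)`. -/
noncomputable def dtauBar (f : ℂ → ℂ) (z : ℂ) : ℂ :=
  (1 / 2) * (du f z + Complex.I * dv f z)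

/-- The Maass raising operator `R_k f = 2i ∂_τ f + (k/v) f`. -/
noncomputable def Rop (k : ℤ) (f : ℂ → ℂ) (z : ℂ) : ℂ :=
  2 * Complex.I * dtau f z + ((k : ℂ) / (z.im : ℂ)) * f z

/-- The Maass lowering operator `L_k f = −2i v² ∂_τ̄ f`. -/
noncomputable def Lop (_k : ℤ) (f : ℂ → ℂ) (z : ℂ) : ℂ :=
  -2 * Complex.I * (z.im : ℂ) ^ 2 * dtauBar f z

/-- The weight-`k` hyperbolic Laplacian
`Δ_k f = −v²(∂²f/∂u² + ∂²f/∂v²) + i k v (∂f/∂u + i ∂f/∂v)`. -/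
noncomputable def Lap (k : ℤ) (f : ℂ → ℂ) (z : ℂ) : ℂ :=
  -(z.im : ℂ) ^ 2 * (du (du f) z + dv (dv f) z)
    + Complex.I * (k : ℂ) * (z.im : ℂ) * (du f z + Complex.I * dv f z)

/-- Iterated raising operator `R_k^r = R_{k+2(r−1)} ∘ ⋯ ∘ R_{k+2} ∘ R_k`, `R_k^0 = id`. -/
noncomputable def Riter (k : ℤ) : ℕ → (ℂ → ℂ) → ℂ → ℂ
  | 0, f => f
  | r + 1, f => Rop (k + 2 * (r : ℤ)) (Riter k r f)

/-- Iterated lowering operator `L_k^r = L_{k−2(r−1)} ∘ ⋯ ∘ L_{k−2} ∘ L_k`, `L_k^0 = id`. -/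
noncomputable def Liter (k : ℤ) : ℕ → (ℂ → ℂ) → ℂ → ℂ
  | 0, f => f
  | r + 1, f => Lop (k - 2 * (r : ℤ)) (Liter k r f)

lemma isOpen_UH : IsOpen UH := isOpen_lt continuous_const Complex.continuous_im

lemma contDiffOn_fderiv_apply {f : ℂ → ℂ} (hf : ContDiffOn ℝ (⊤ : ℕ∞) f UH) (e : ℂ) :
    ContDiffOn ℝ (⊤ : ℕ∞) (fun z => fderiv ℝ f z e) UH :=
  (hf.fderiv_of_isOpen isOpen_UH (by simp)).clm_apply contDiffOn_const

lemma contDiffOn_du {f : ℂ → ℂ} (hf : ContDiffOn ℝ (⊤ : ℕ∞) f UH) :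
    ContDiffOn ℝ (⊤ : ℕ∞) (du f) UH := contDiffOn_fderiv_apply hf 1

lemma contDiffOn_dv {f : ℂ → ℂ} (hf : ContDiffOn ℝ (⊤ : ℕ∞) f UH) :
    ContDiffOn ℝ (⊤ : ℕ∞) (dv f) UH := contDiffOn_fderiv_apply hf Complex.I

lemma differentiableAt_of_contDiffOn_UH {f : ℂ → ℂ} (hf : ContDiffOn ℝ (⊤ : ℕ∞) f UH) {z : ℂ}
    (hz : z ∈ UH) : DifferentiableAt ℝ f z :=
  (hf.contDiffAt (isOpen_UH.mem_nhds hz)).differentiableAt (by simp)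

lemma du_dv_comm {f : ℂ → ℂ} (hf : ContDiffOn ℝ (⊤ : ℕ∞) f UH) {z : ℂ} (hz : z ∈ UH) :
    du (dv f) z = dv (du f) z := by
  have hd : DifferentiableAt ℝ (fderiv ℝ f) z :=
    ((hf.fderiv_of_isOpen isOpen_UH (m := (⊤ : ℕ∞)) (by simp)).contDiffAt
      (isOpen_UH.mem_nhds hz)).differentiableAt (by simp)
  have key (e e' : ℂ) : fderiv ℝ (fun w => fderiv ℝ f w e) z e' = fderiv ℝ (fderiv ℝ f) z e' e := by
    rw [fderiv_clm_apply hd (differentiableAt_const e)]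
    simp
  have hs : IsSymmSndFDerivAt ℝ f z :=
    (hf.contDiffAt (isOpen_UH.mem_nhds hz)).isSymmSndFDerivAt (by
      simpa using (WithTop.coe_le_coe.mpr le_top : ((2 : ℕ∞) : WithTop ℕ∞) ≤ ((⊤ : ℕ∞) : WithTop ℕ∞)))
  exact (key _ _).trans ((hs _ _).trans (key _ _).symm)

/-- The imaginary part as a complex-valued real-linear map. -/
def imOfReal : ℂ →L[ℝ] ℂ := Complex.ofRealCLM.comp Complex.imCLM

lemma hasFDerivAt_imOfReal (z : ℂ) : HasFDerivAt (fun w : ℂ => (w.im : ℂ)) imOfReal z :=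
  imOfReal.hasFDerivAt

lemma imOfReal_apply (z : ℂ) : imOfReal z = (z.im : ℂ) := rfl

lemma Rop_eq (k : ℤ) (g : ℂ → ℂ) (z : ℂ) :
    Rop k g z = Complex.I * du g z + dv g z + (k : ℂ) * (z.im : ℂ)⁻¹ * g z := by
  unfold Rop dtau
  linear_combination (-dv g z) * Complex.I_sq

lemma Lop_eq (k : ℤ) (g : ℂ → ℂ) (z : ℂ) :
    Lop k g z = (z.im : ℂ) ^ 2 * (dv g z - Complex.I * du g z) := by
  unfold Lop dtauBar
  linear_combination (-(z.im : ℂ) ^ 2 * dv g z) * Complex.I_sq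

lemma contDiffOn_Rop (k : ℤ) {g : ℂ → ℂ} (hg : ContDiffOn ℝ (⊤ : ℕ∞) g UH) :
    ContDiffOn ℝ (⊤ : ℕ∞) (Rop k g) UH := by
  have hinv : ContDiffOn ℝ (⊤ : ℕ∞) (fun z : ℂ => (z.im : ℂ)⁻¹) UH :=
    (imOfReal.contDiff.contDiffOn (s := UH)).inv fun z hz => by
      simpa [imOfReal_apply] using ne_of_gt (show 0 < z.im from hz)
  rw [funext (Rop_eq k g)]
  exact ((contDiffOn_const.mul (contDiffOn_du hg)).add (contDiffOn_dv hg)).add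
    ((contDiffOn_const.mul hinv).mul hg)

lemma contDiffOn_Riter (k : ℤ) {f : ℂ → ℂ} (hf : ContDiffOn ℝ (⊤ : ℕ∞) f UH) (r : ℕ) :
    ContDiffOn ℝ (⊤ : ℕ∞) (Riter k r f) UH := by
  induction r with
  | zero => exact hf
  | succ r ih => exact contDiffOn_Rop _ ih

lemma fderiv_Rop_apply (k : ℤ) {g : ℂ → ℂ} (hg : ContDiffOn ℝ (⊤ : ℕ∞) g UH) {z : ℂ}
    (hz : z ∈ UH) (e : ℂ) :
    fderiv ℝ (Rop k g) z e = Complex.I * fderiv ℝ (du g) z e + fderiv ℝ (dv g) z e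
      + (k : ℂ) * ((z.im : ℂ)⁻¹ * fderiv ℝ g z e - (e.im : ℂ) * ((z.im : ℂ) ^ 2)⁻¹ * g z) := by
  have hv : (z.im : ℂ) ≠ 0 := by exact_mod_cast ne_of_gt (show 0 < z.im from hz)
  have hP := (differentiableAt_of_contDiffOn_UH (contDiffOn_du hg) hz).hasFDerivAt
  have hQ := (differentiableAt_of_contDiffOn_UH (contDiffOn_dv hg) hz).hasFDerivAt
  have hG := (differentiableAt_of_contDiffOn_UH hg hz).hasFDerivAt
  have hi := (hasDerivAt_inv hv).comp_hasFDerivAt_of_eq z (hasFDerivAt_imOfReal z) rfl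
  have h := ((hP.const_mul Complex.I).add hQ).add ((hi.const_mul (k : ℂ)).mul hG)
  rw [funext (Rop_eq k g)]
  refine (congrArg (· e) h.fderiv).trans ?_
  simp [imOfReal_apply]
  ring

lemma fderiv_Lop_apply (k : ℤ) {g : ℂ → ℂ} (hg : ContDiffOn ℝ (⊤ : ℕ∞) g UH) {z : ℂ}
    (hz : z ∈ UH) (e : ℂ) :
    fderiv ℝ (Lop k g) z e = 2 * (z.im : ℂ) * (e.im : ℂ) * (dv g z - Complex.I * du g z)
      + (z.im : ℂ) ^ 2 * (fderiv ℝ (dv g) z e - Complex.I * fderiv ℝ (du g) z e) := by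
  have hP := (differentiableAt_of_contDiffOn_UH (contDiffOn_du hg) hz).hasFDerivAt
  have hQ := (differentiableAt_of_contDiffOn_UH (contDiffOn_dv hg) hz).hasFDerivAt
  have h := ((hasFDerivAt_imOfReal z).pow 2).mul (hQ.sub (hP.const_mul Complex.I))
  rw [funext (Lop_eq k g)]
  refine (congrArg (· e) h.fderiv).trans ?_
  simp [imOfReal_apply]
  ring

/-- Lowering after raising is the negative Laplacian, shifted by the weight. -/
lemma Lop_Rop (l k : ℤ) {g : ℂ → ℂ} (hg : ContDiffOn ℝ (⊤ : ℕ∞) g UH) {z : ℂ} (hz : z ∈ UH) :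
    Lop l (Rop k g) z = -Lap k g z - k * g z := by
  have hv : (z.im : ℂ) ≠ 0 := by exact_mod_cast ne_of_gt (show 0 < z.im from hz)
  have hc := du_dv_comm hg hz
  have h1 := fderiv_Rop_apply k hg hz 1
  have h2 := fderiv_Rop_apply k hg hz Complex.I
  rw [Lop_eq, Lap]
  simp only [du, dv] at *
  rw [h1, h2, hc]
  simp only [Complex.one_im, Complex.I_im, Complex.ofReal_zero, Complex.ofReal_one]
  field_simp
  ring_nf
  simp only [Complex.I_sq]
  ring

/-- Raising after lowering is the negative Laplacian. -/
lemma Rop_Lop (l k : ℤ) {g : ℂ → ℂ} (hg : ContDiffOn ℝ (⊤ : ℕ∞) g UH) {z : ℂ} (hz : z ∈ UH) :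
    Rop (k - 2) (Lop l g) z = -Lap k g z := by
  have hv : (z.im : ℂ) ≠ 0 := by exact_mod_cast ne_of_gt (show 0 < z.im from hz)
  have hc := du_dv_comm hg hz
  have h1 := fderiv_Lop_apply l hg hz 1
  have h2 := fderiv_Lop_apply l hg hz Complex.I
  rw [Rop_eq, Lap, Lop_eq]
  simp only [du, dv] at *
  rw [h1, h2, hc]
  simp only [Complex.one_im, Complex.I_im, Complex.ofReal_zero, Complex.ofReal_one]
  push_cast
  field_simp
  ring_nf
  simp only [Complex.I_sq]
  ring

lemma Rop_congr_const_mul (k : ℤ) {g h : ℂ → ℂ} (c : ℂ) (hh : ContDiffOn ℝ (⊤ : ℕ∞) h UH)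
    (hgh : ∀ z ∈ UH, g z = c * h z) {z : ℂ} (hz : z ∈ UH) : Rop k g z = c * Rop k h z := by
  have he : g =ᶠ[nhds z] fun w => c * h w :=
    Filter.eventually_of_mem (isOpen_UH.mem_nhds hz) hgh
  have hd : fderiv ℝ g z = c • fderiv ℝ h z := by
    rw [he.fderiv_eq]
    exact ((differentiableAt_of_contDiffOn_UH hh hz).hasFDerivAt.const_mul c).fderiv
  rw [Rop_eq, Rop_eq, hgh z hz]
  simp only [du, dv, hd, smul_apply, smul_eq_mul]
  ring

/-- Lowering an iterated raising of a harmonic function gives a multiple of the previous one. -/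
lemma Lop_Riter_succ (k : ℤ) {f : ℂ → ℂ} (hf : ContDiffOn ℝ (⊤ : ℕ∞) f UH)
    (hharm : ∀ z ∈ UH, Lap k f z = 0) (l : ℤ) (r : ℕ) :
    ∀ z ∈ UH, Lop l (Riter k (r + 1) f) z = -((r + 1) * (k + r)) * Riter k r f z := by
  induction r with
  | zero =>
    intro z hz
    simp only [Riter]
    rw [Lop_Rop _ _ hf hz]
    simp [hharm z hz]
  | succ r ih =>
    intro z hz
    have hg := contDiffOn_Riter k hf (r + 1)
    have h1 := Lop_Rop l (k + 2 * ((r + 1 : ℕ) : ℤ)) hg hz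
    have h2 := Rop_Lop l (k + 2 * ((r + 1 : ℕ) : ℤ)) hg hz
    have h3 := Rop_congr_const_mul (k + 2 * (r : ℤ)) _ (contDiffOn_Riter k hf r) ih hz
    rw [show k + 2 * ((r + 1 : ℕ) : ℤ) - 2 = k + 2 * (r : ℤ) by push_cast; ring, h3] at h2
    change Lop l (Rop (k + 2 * ((r + 1 : ℕ) : ℤ)) (Riter k (r + 1) f)) z = _
    rw [h1, ← h2]
    change -((r + 1) * (k + r) : ℂ) * Riter k (r + 1) f z - _ = _
    push_cast
    ring

lemma differentiableAt_of_Lop_eq_zero {k : ℤ} {g : ℂ → ℂ} {z : ℂ} (hz : z ∈ UH)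
    (hg : DifferentiableAt ℝ g z) (h : Lop k g z = 0) : DifferentiableAt ℂ g z := by
  have hv : (z.im : ℂ) ≠ 0 := by exact_mod_cast ne_of_gt (show 0 < z.im from hz)
  rw [differentiableAt_complex_iff_differentiableAt_real]
  refine ⟨hg, ?_⟩
  rw [Lop_eq] at h
  exact sub_eq_zero.mp ((mul_eq_zero.mp h).resolve_left (pow_ne_zero 2 hv))

/-- if `k < 1` and `Δ_k f = 0` then `L_{2−k}(R_k^{1−k} f) = 0`, i.e.
`R_k^{1−k} f` is holomorphic on the upper half-plane. -/
theorem stmt3 (k : ℤ) (hk : k < 1) (f : ℂ → ℂ) (hf : ContDiffOn ℝ (⊤ : ℕ∞) f UH)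
    (hharm : ∀ z ∈ UH, Lap k f z = 0) :
    (∀ z ∈ UH, Lop (2 - k) (Riter k (1 - k).toNat f) z = 0) ∧
    DifferentiableOn ℂ (Riter k (1 - k).toNat f) UH := by
  obtain ⟨n, hn⟩ : ∃ n : ℕ, (1 - k).toNat = n + 1 := ⟨(-k).toNat, by omega⟩
  have hkn : (k : ℂ) + n = 0 := by
    have : k + n = 0 := by omega
    exact_mod_cast this
  have hL : ∀ z ∈ UH, Lop (2 - k) (Riter k (1 - k).toNat f) z = 0 := fun z hz => by
    rw [hn, Lop_Riter_succ k hf hharm _ _ z hz, hkn]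
    ring
  exact ⟨hL, fun z hz => (differentiableAt_of_Lop_eq_zero hz
    (differentiableAt_of_contDiffOn_UH (contDiffOn_Riter k hf _) hz) (hL z hz)).differentiableWithinAt⟩
end
end

section
/- Let m ∈ ℕ and 0 ≤ r ≤ m. For every γ = [[a,b],[c,d]] ∈ SL₂(ℝ) and every τ ∈ ℍ, the 𝒫_m-valued function e_{r,m−r} satisfies e_{r,m−r}(γτ) = (cτ+d)^{m−2r} · ρ_m(γ) e_{r,m−r}(τ). -/
open Complex

noncomputable section

/-- The `𝒫_m`-valued function
`e_{r,m−r}(τ)(X) = ((−1)^{m−r}/r!) v^{r−m} (X−τ)^r (X−conj(τ))^{m−r}`,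
as a polynomial in `X`. -/
noncomputable def epoly (m r : ℕ) (τ : ℂ) : Polynomial ℂ :=
  Polynomial.C ((-1 : ℂ) ^ (m - r) / (r.factorial : ℂ) * (τ.im : ℂ) ^ ((r : ℤ) - (m : ℤ))) *
    (Polynomial.X - Polynomial.C τ) ^ r *
    (Polynomial.X - Polynomial.C ((starRingEnd ℂ) τ)) ^ (m - r)

/-- The representation `ρ_m` of `SL₂` on polynomials of degree ≤ m:
`(ρ_m(γ)p)(X) = (−cX+a)^m p((dX−b)/(−cX+a))`, written polynomially for `deg p ≤ m`. -/
noncomputable def rho (m : ℕ) (a b c d : ℂ) (p : Polynomial ℂ) : Polynomial ℂ :=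
  ∑ j ∈ Finset.range (m + 1), Polynomial.C (p.coeff j) *
    (Polynomial.C d * Polynomial.X - Polynomial.C b) ^ j *
    (-(Polynomial.C c) * Polynomial.X + Polynomial.C a) ^ (m - j)

/-- Möbius action of `SL₂(ℝ)`: `γτ = (aτ+b)/(cτ+d)`. -/
noncomputable def moeb (g : Matrix.SpecialLinearGroup (Fin 2) ℝ) (z : ℂ) : ℂ :=
  ((g.1 0 0 : ℂ) * z + (g.1 0 1 : ℂ)) / ((g.1 1 0 : ℂ) * z + (g.1 1 1 : ℂ))

open Polynomial in
theorem rho_C_mul (m : ℕ) (a b c d k : ℂ) (p : ℂ[X]) :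
    rho m a b c d (C k * p) = C k * rho m a b c d p := by
  simp only [rho, Finset.mul_sum, coeff_C_mul, C_mul, mul_assoc]

open Polynomial in
theorem rho_X_sub_C_mul (m : ℕ) (a b c d s : ℂ) (p : ℂ[X]) (hp : p.natDegree ≤ m) :
    rho (m + 1) a b c d ((X - C s) * p)
      = ((C d * X - C b) - C s * (-(C c) * X + C a)) * rho m a b c d p := by
  have hX : rho (m + 1) a b c d (X * p) = (C d * X - C b) * rho m a b c d p := by
    unfold rho
    rw [Finset.sum_range_succ', Finset.mul_sum]
    simp only [coeff_X_mul, coeff_X_mul_zero, map_zero, zero_mul, add_zero,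
      Nat.add_sub_add_right]
    exact Finset.sum_congr rfl fun j _ => by ring
  have hW : rho (m + 1) a b c d p = (-(C c) * X + C a) * rho m a b c d p := by
    unfold rho
    rw [Finset.sum_range_succ, Finset.mul_sum, coeff_eq_zero_of_natDegree_lt (by omega)]
    simp only [map_zero, zero_mul, add_zero]
    refine Finset.sum_congr rfl fun j hj => ?_
    rw [Nat.succ_sub (Nat.lt_succ_iff.mp (Finset.mem_range.mp hj)), pow_succ]
    ring
  have hsub : rho (m + 1) a b c d ((X - C s) * p)
      = rho (m + 1) a b c d (X * p) - rho (m + 1) a b c d (C s * p) := by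
    simp only [rho, sub_mul, coeff_sub, C_sub, Finset.sum_sub_distrib]
  rw [hsub, rho_C_mul, hX, hW]
  ring

open Polynomial in
theorem natDegree_X_sub_C_pow_mul_pow_le (r n : ℕ) (s t : ℂ) :
    ((X - C s) ^ r * (X - C t) ^ n).natDegree ≤ r + n := by
  compute_degree

open Polynomial in
theorem rho_X_sub_C_pow_mul_pow (a b c d s t : ℂ) (r n : ℕ) :
    rho (r + n) a b c d ((X - C s) ^ r * (X - C t) ^ n)
      = ((C d * X - C b) - C s * (-(C c) * X + C a)) ^ r *
        ((C d * X - C b) - C t * (-(C c) * X + C a)) ^ n := by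
  induction r with
  | zero =>
    induction n with
    | zero => simp [rho]
    | succ n ih =>
      have h := rho_X_sub_C_mul (0 + n) a b c d t _ (natDegree_X_sub_C_pow_mul_pow_le 0 n s t)
      rw [ih] at h
      rw [← add_assoc, pow_succ' (X - C t), mul_left_comm, h]
      ring
  | succ r ih =>
    have h := rho_X_sub_C_mul (r + n) a b c d s _ (natDegree_X_sub_C_pow_mul_pow_le r n s t)
    rw [ih] at h
    rw [add_right_comm, pow_succ' (X - C s), mul_assoc, h]
    ring

open Polynomial in
theorem linear_factor_eq {a b c d s : ℂ} (h : c * s + d ≠ 0) :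
    (C d * X - C b) - C s * (-(C c) * X + C a)
      = C (c * s + d) * (X - C ((a * s + b) / (c * s + d))) := by
  rw [mul_sub, ← C_mul, mul_div_cancel₀ _ h]
  simp only [C_add, C_mul]
  ring

theorem denom_ne_zero_of_mem_UH (γ : Matrix.SpecialLinearGroup (Fin 2) ℝ) {τ : ℂ}
    (hτ : τ ∈ UH) : (γ.1 1 0 : ℂ) * τ + (γ.1 1 1 : ℂ) ≠ 0 := by
  intro h
  have hre := congrArg Complex.re h
  have him := congrArg Complex.im h
  have hdet := γ.2
  rw [Matrix.det_fin_two] at hdet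
  have hc : γ.1 1 0 = 0 := by
    simpa [(show 0 < τ.im from hτ).ne'] using him
  have hd : γ.1 1 1 = 0 := by
    simpa [hc] using hre
  simp [hc, hd] at hdet

theorem im_moeb (γ : Matrix.SpecialLinearGroup (Fin 2) ℝ) {τ : ℂ} (hτ : τ ∈ UH) :
    ((moeb γ τ).im : ℂ) = τ.im / (((γ.1 1 0 : ℂ) * τ + (γ.1 1 1 : ℂ)) *
      ((γ.1 1 0 : ℂ) * (starRingEnd ℂ) τ + (γ.1 1 1 : ℂ))) := by
  have hJ := denom_ne_zero_of_mem_UH γ hτ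
  have hJ' : (γ.1 1 0 : ℂ) * (starRingEnd ℂ) τ + (γ.1 1 1 : ℂ) ≠ 0 := by
    simpa using (map_ne_zero (starRingEnd ℂ)).mpr hJ
  have hdet : (γ.1 0 0 : ℂ) * γ.1 1 1 - γ.1 0 1 * γ.1 1 0 = 1 := by
    have h := γ.2
    rw [Matrix.det_fin_two] at h
    exact_mod_cast h
  rw [Complex.im_eq_sub_conj, Complex.im_eq_sub_conj, moeb]
  simp only [map_div₀, map_add, map_mul, Complex.conj_ofReal]
  rw [div_sub_div _ _ hJ hJ', div_right_comm]
  congr 2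
  linear_combination (τ - (starRingEnd ℂ) τ) * hdet

/-- `e_{r,m−r}(γτ) = (cτ+d)^{m−2r} ρ_m(γ) e_{r,m−r}(τ)` for all
`γ ∈ SL₂(ℝ)` and `τ` in the upper half-plane. -/
theorem stmt13 (m r : ℕ) (hr : r ≤ m) (γ : Matrix.SpecialLinearGroup (Fin 2) ℝ)
    (τ : ℂ) (hτ : τ ∈ UH) :
    epoly m r (moeb γ τ)
      = Polynomial.C (((γ.1 1 0 : ℂ) * τ + (γ.1 1 1 : ℂ)) ^ ((m : ℤ) - 2 * (r : ℤ))) *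
          rho m (γ.1 0 0 : ℂ) (γ.1 0 1 : ℂ) (γ.1 1 0 : ℂ) (γ.1 1 1 : ℂ) (epoly m r τ) := by
  obtain ⟨n, rfl⟩ := Nat.exists_eq_add_of_le hr
  have hJ := denom_ne_zero_of_mem_UH γ hτ
  have hJ' : (γ.1 1 0 : ℂ) * (starRingEnd ℂ) τ + (γ.1 1 1 : ℂ) ≠ 0 := by
    simpa using (map_ne_zero (starRingEnd ℂ)).mpr hJ
  have hconj : (starRingEnd ℂ) (moeb γ τ) = ((γ.1 0 0 : ℂ) * (starRingEnd ℂ) τ + (γ.1 0 1 : ℂ)) /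
      ((γ.1 1 0 : ℂ) * (starRingEnd ℂ) τ + (γ.1 1 1 : ℂ)) := by
    simp [moeb]
  have hmoeb : moeb γ τ = ((γ.1 0 0 : ℂ) * τ + (γ.1 0 1 : ℂ)) /
      ((γ.1 1 0 : ℂ) * τ + (γ.1 1 1 : ℂ)) := rfl
  have hexp : ((r : ℤ) - ((r + n : ℕ) : ℤ)) = -(n : ℤ) := by push_cast; ring
  have hexp' : (((r + n : ℕ) : ℤ) - 2 * (r : ℤ)) = (n : ℤ) - (r : ℤ) := by push_cast; ring
  unfold epoly
  rw [mul_assoc (Polynomial.C _), mul_assoc (Polynomial.C _), rho_C_mul, Nat.add_sub_cancel_left,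
    rho_X_sub_C_pow_mul_pow, linear_factor_eq hJ, linear_factor_eq hJ', hconj, im_moeb γ hτ,
    hexp, hexp', zpow_sub₀ hJ]
  simp only [zpow_neg, zpow_natCast]
  rw [← hmoeb, mul_pow, mul_pow (Polynomial.C _), ← Polynomial.C_pow, ← Polynomial.C_pow]
  generalize (γ.1 1 0 : ℂ) * (starRingEnd ℂ) τ + (γ.1 1 1 : ℂ) = J' at *
  generalize (γ.1 1 0 : ℂ) * τ + (γ.1 1 1 : ℂ) = J at *
  have hcoeff (k v : ℂ) : k * ((v / (J * J')) ^ n)⁻¹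
      = J ^ n / J ^ r * (k * (v ^ n)⁻¹) * J ^ r * J' ^ n := by
    rw [div_pow, mul_pow]
    field_simp
  rw [hcoeff]
  simp only [Polynomial.C_mul]
  ring
end
end
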